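/- Let M be an invertible real n × n matrix, let ψ : ℝ^n → ℝ be a continuously differentiable strictly convex function satisfying ψ(p)/‖p‖ → ∞ as ‖p‖ → ∞, and let b ∈ ℝ^n be a constant vector. Set p₀ = 0 and q₀ = (Mᵀ)⁻¹ b − (Mᵀ)⁻¹ ∇ψ(0). Then every pair of differentiable curves q, p : [0, ∞) → ℝ^n satisfying q'(t) = M p(t) and p'(t) = −Mᵀ q(t) − ∇ψ(p(t)) + b for all t ≥ 0 converges: p(t) → 0 and q(t) → q₀ as t → ∞. -/

import Mathlib

open Set Filter

open scoped Topology RealInnerProductSpace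

/-- Barbalat's lemma. -/
theorem tendsto_deriv_zero_of_uniformContinuousOn {E : Type*} [NormedAddCommGroup E]
    [NormedSpace ℝ E] {f f' : ℝ → E} {L : E}
    (hf : ∀ t, 0 ≤ t → HasDerivAt f (f' t) t) (hL : Tendsto f atTop (𝓝 L))
    (huc : UniformContinuousOn f' (Ici 0)) : Tendsto f' atTop (𝓝 0) := by
  rw [Metric.tendsto_atTop]
  intro ε hε
  obtain ⟨δ, hδ, huc⟩ := Metric.uniformContinuousOn_iff.1 huc (ε / 2) (by positivity)
  set d := δ / 2 with hd
  have hd0 : 0 < d := by positivity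
  obtain ⟨N, hN⟩ := Metric.tendsto_atTop.1 hL (d * ε / 4) (by positivity)
  refine ⟨max N 0, fun t ht => ?_⟩
  have ht0 : 0 ≤ t := (le_max_right _ _).trans ht
  have htN : N ≤ t := (le_max_left _ _).trans ht
  have hmv := norm_image_sub_le_of_norm_deriv_le_segment' (a := t) (b := t + d)
    (f := fun s => f s - (s - t) • f' t) (f' := fun s => f' s - f' t) (C := ε / 2)
    (fun s hs => by
      have h := (hf s (ht0.trans hs.1)).fun_sub
        (((hasDerivAt_id' s).sub_const t).smul_const (f' t))
      rw [one_smul] at h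
      exact h.hasDerivWithinAt)
    (fun s hs => by
      rw [← dist_eq_norm]
      refine (huc s (ht0.trans hs.1) t ht0 ?_).le
      rw [Real.dist_eq, abs_of_nonneg (by linarith [hs.1])]
      linarith [hs.2])
    (t + d) ⟨by linarith, le_rfl⟩
  simp only [add_sub_cancel_left, sub_self, zero_smul, sub_zero] at hmv
  have hdist : ‖f (t + d) - f t‖ < d * ε / 4 + d * ε / 4 := by
    rw [← dist_eq_norm]
    exact (dist_triangle_right _ _ L).trans_lt
      (add_lt_add (hN _ (by linarith)) (hN _ htN))
  have hsmul : ‖d • f' t‖ < d * ε := by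
    have h : d • f' t = (f (t + d) - f t) - (f (t + d) - d • f' t - f t) := by abel
    rw [h]
    linarith [norm_sub_le (f (t + d) - f t) (f (t + d) - d • f' t - f t)]
  rw [norm_smul, Real.norm_of_nonneg hd0.le] at hsmul
  rw [dist_zero_right]
  exact lt_of_mul_lt_mul_left hsmul hd0.le

/-- A continuous observable is uniformly continuous in time along a solution of an autonomous ODE
that stays in a compact set. -/
theorem uniformContinuousOn_comp_of_hasDerivAt_of_isCompact {E G : Type*}
    [NormedAddCommGroup E] [NormedSpace ℝ E] [UniformSpace G] {F : E → E} (hF : Continuous F)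
    {K : Set E} (hK : IsCompact K)
    {z : ℝ → E} (hz : ∀ t, 0 ≤ t → HasDerivAt z (F (z t)) t) (hzK : MapsTo z (Ici 0) K)
    {h : E → G} (hh : Continuous h) : UniformContinuousOn (fun t => h (z t)) (Ici 0) := by
  obtain ⟨C, hC⟩ := hK.exists_bound_of_continuousOn hF.continuousOn
  refine (hK.uniformContinuousOn_of_continuous hh.continuousOn).comp
    (LipschitzOnWith.uniformContinuousOn (K := C.toNNReal) ?_) hzK
  refine (convex_Ici (0 : ℝ)).lipschitzOnWith_of_nnnorm_hasDerivWithin_le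
    (fun t ht => (hz t ht).hasDerivWithinAt) fun t ht => ?_
  rw [← norm_toNNReal]
  exact Real.toNNReal_le_toNNReal (hC _ (hzK ht))

/-- If `h ∘ u` converges to `y`, where `u` takes values in a compact set on which `h` attains `y`
only at `x₀`, then `u` converges to `x₀`. -/
theorem tendsto_of_tendsto_comp_of_isCompact {X Y α : Type*} [TopologicalSpace X]
    [TopologicalSpace Y] [T2Space Y] {l : Filter α} {K : Set X} (hK : IsCompact K) {u : α → X}
    (hu : ∀ᶠ t in l, u t ∈ K) {h : X → Y} (hh : Continuous h) {x₀ : X} {y : Y}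
    (hlim : Tendsto (h ∘ u) l (𝓝 y)) (huniq : ∀ x ∈ K, h x = y → x = x₀) :
    Tendsto u l (𝓝 x₀) := by
  refine hK.tendsto_nhds_of_unique_mapClusterPt hu fun x hx hcl => huniq x hx ?_
  exact eq_of_nhds_neBot ((hcl.continuousAt_comp hh.continuousAt).clusterPt.mono hlim)

/-- The gradient of a differentiable strictly convex function is strictly monotone. -/
theorem StrictConvexOn.inner_gradient_sub_pos {E : Type*} [NormedAddCommGroup E]
    [InnerProductSpace ℝ E] [CompleteSpace E] {ψ : E → ℝ} (hconv : StrictConvexOn ℝ univ ψ)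
    (hψ : Differentiable ℝ ψ) {x y : E} (hxy : x ≠ y) :
    0 < ⟪x - y, gradient ψ x - gradient ψ y⟫ := by
  have hline : StrictConvexOn ℝ univ (fun s : ℝ => ψ (y + s • (x - y))) := by
    refine ⟨convex_univ, fun s _ t _ hst a c ha hc hac => ?_⟩
    have hne : y + s • (x - y) ≠ y + t • (x - y) := fun h =>
      hst (smul_left_injective ℝ (sub_ne_zero.2 hxy) (add_left_cancel h))
    have h := hconv.2 (mem_univ _) (mem_univ _) hne ha hc hac
    have heq : y + (a • s + c • t) • (x - y)
        = a • (y + s • (x - y)) + c • (y + t • (x - y)) := by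
      obtain rfl : c = 1 - a := by linarith
      simp only [smul_eq_mul]
      module
    change ψ (y + (a • s + c • t) • (x - y)) < _
    rwa [heq]
  have hderiv : ∀ s : ℝ, HasDerivAt (fun s : ℝ => ψ (y + s • (x - y)))
      ⟪gradient ψ (y + s • (x - y)), x - y⟫ s := fun s => by
    have h := (hψ (y + s • (x - y))).hasFDerivAt.comp_hasDerivAt s
      (((hasDerivAt_id' s).smul_const (x - y)).const_add y)
    rwa [one_smul, ← inner_gradient_left] at h
  have h := (hline.lt_slope_of_hasDerivAt (mem_univ 0) (mem_univ 1) one_pos (hderiv 0)).trans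
    (hline.slope_lt_of_hasDerivAt (mem_univ 0) (mem_univ 1) one_pos (hderiv 1))
  rw [real_inner_comm, inner_sub_left]
  simpa using h

/-- Convergence of the oscillatory system `ṙ = Ap`, `ṗ = −Br − g(p)` with `B` the injective
transpose of `A` and strictly dissipative damping `g`. -/
theorem tendsto_zero_of_oscillatory_system {E : Type*} [NormedAddCommGroup E]
    [InnerProductSpace ℝ E] [FiniteDimensional ℝ E] {A B : E →L[ℝ] E}
    (hAB : ∀ x y, ⟪x, A y⟫ = ⟪B x, y⟫) (hB : Function.Injective B) {g : E → E}
    (hg : Continuous g) (hg0 : g 0 = 0) (hgpos : ∀ x, x ≠ 0 → 0 < ⟪x, g x⟫)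
    {r p : ℝ → E} (hr : ∀ t, 0 ≤ t → HasDerivAt r (A (p t)) t)
    (hp : ∀ t, 0 ≤ t → HasDerivAt p (-B (r t) - g (p t)) t) :
    Tendsto p atTop (𝓝 0) ∧ Tendsto r atTop (𝓝 0) := by
  set V : ℝ → ℝ := fun t => ‖p t‖ ^ 2 + ‖r t‖ ^ 2 with hV
  have hVderiv : ∀ t, 0 ≤ t → HasDerivAt V (-2 * ⟪p t, g (p t)⟫) t := fun t ht => by
    refine ((hp t ht).norm_sq.add (hr t ht).norm_sq).congr_deriv ?_
    rw [inner_sub_right, inner_neg_right, hAB, real_inner_comm]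
    ring
  have hgnonneg : ∀ x, 0 ≤ ⟪x, g x⟫ := fun x => by
    rcases eq_or_ne x 0 with rfl | hx
    · simp
    · exact (hgpos x hx).le
  have hVanti : AntitoneOn V (Ici 0) :=
    antitoneOn_of_hasDerivWithinAt_nonpos (convex_Ici 0)
      (fun t ht => (hVderiv t ht).continuousAt.continuousWithinAt)
      (fun t ht => (hVderiv t (interior_subset ht)).hasDerivWithinAt)
      (fun t _ => by linarith [hgnonneg (p t)])
  obtain ⟨L, hL⟩ : ∃ L, Tendsto V atTop (𝓝 L) := by
    have hanti : Antitone fun t => V (max t 0) := fun s t hst =>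
      hVanti (le_max_right s 0) (le_max_right t 0) (max_le_max_right 0 hst)
    have hbdd : BddBelow (range fun t => V (max t 0)) :=
      ⟨0, by rintro _ ⟨t, rfl⟩; positivity⟩
    refine ⟨_, (tendsto_atTop_ciInf hanti hbdd).congr' ?_⟩
    filter_upwards [eventually_ge_atTop 0] with t ht
    rw [max_eq_left ht]
  set R := √(V 0)
  have hpK : ∀ t, 0 ≤ t → p t ∈ Metric.closedBall 0 R := fun t ht => by
    rw [mem_closedBall_zero_iff]
    refine Real.le_sqrt_of_sq_le (le_trans ?_ (hVanti self_mem_Ici ht ht))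
    exact le_add_of_nonneg_right (sq_nonneg _)
  have hrK : ∀ t, 0 ≤ t → r t ∈ Metric.closedBall 0 R := fun t ht => by
    rw [mem_closedBall_zero_iff]
    refine Real.le_sqrt_of_sq_le (le_trans ?_ (hVanti self_mem_Ici ht ht))
    exact le_add_of_nonneg_left (sq_nonneg _)
  have hball : IsCompact (Metric.closedBall (0 : E) R) := isCompact_closedBall 0 R
  have hzK : MapsTo (fun t => (p t, r t)) (Ici 0)
      (Metric.closedBall (0 : E) R ×ˢ Metric.closedBall (0 : E) R) :=
    fun t ht => ⟨hpK t ht, hrK t ht⟩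
  have hF : Continuous fun z : E × E => (-B z.2 - g z.1, A z.1) := by fun_prop
  have hz : ∀ t, 0 ≤ t → HasDerivAt (fun t => (p t, r t)) (-B (r t) - g (p t), A (p t)) t :=
    fun t ht => (hp t ht).prodMk (hr t ht)
  have hp0 : Tendsto p atTop (𝓝 0) := by
    refine tendsto_of_tendsto_comp_of_isCompact hball
      ((eventually_ge_atTop 0).mono hpK) (h := fun x => -2 * ⟪x, g x⟫) (by fun_prop)
      (tendsto_deriv_zero_of_uniformContinuousOn hVderiv hL
        (uniformContinuousOn_comp_of_hasDerivAt_of_isCompact hF (hball.prod hball) hz hzK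
      (h := fun z => -2 * ⟪z.1, g z.1⟫) (by fun_prop))) fun x _ hx => ?_
    by_contra hne
    linarith [hgpos x hne]
  refine ⟨hp0, ?_⟩
  have hpderiv := tendsto_deriv_zero_of_uniformContinuousOn hp hp0
    (uniformContinuousOn_comp_of_hasDerivAt_of_isCompact hF (hball.prod hball) hz hzK
      (h := fun z => -B z.2 - g z.1) (by fun_prop))
  have hgp : Tendsto (fun t => g (p t)) atTop (𝓝 0) := by
    simpa [hg0, Function.comp_def] using (hg.tendsto 0).comp hp0
  refine tendsto_of_tendsto_comp_of_isCompact hball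
    ((eventually_ge_atTop 0).mono hrK) B.continuous (y := 0) ?_ fun x _ hx =>
      hB (hx.trans (map_zero B).symm)
  simpa [Function.comp_def] using (hpderiv.add hgp).neg

/-- the damped oscillatory system `q̇ = Mp`, `ṗ = −Mᵀq − ∇ψ(p) + b`
with `M` invertible and `ψ` a `C¹` strictly convex superlinear function converges:
`p(t) → 0` and `q(t) → q₀ = (Mᵀ)⁻¹ b − (Mᵀ)⁻¹ ∇ψ(0)`. -/
theorem stmt_11 (n : ℕ) (hn : 0 < n)
    (M : Matrix (Fin n) (Fin n) ℝ) (hM : IsUnit M.det)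
    (ψ : EuclideanSpace ℝ (Fin n) → ℝ)
    (hsmooth : ContDiff ℝ 1 ψ)
    (hconv : StrictConvexOn ℝ univ ψ)
    (hcoercive : Tendsto (fun p : EuclideanSpace ℝ (Fin n) => ψ p / ‖p‖)
      (Bornology.cobounded _) atTop)
    (b : EuclideanSpace ℝ (Fin n))
    (q p : ℝ → EuclideanSpace ℝ (Fin n))
    (hq : ∀ t : ℝ, 0 ≤ t → HasDerivAt q (Matrix.toEuclideanLin M (p t)) t)
    (hp : ∀ t : ℝ, 0 ≤ t → HasDerivAt p
      (-(Matrix.toEuclideanLin M.transpose (q t)) - gradient ψ (p t) + b) t) :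
    Tendsto p atTop (nhds 0) ∧
      Tendsto q atTop (nhds
        (Matrix.toEuclideanLin M.transpose⁻¹ b -
          Matrix.toEuclideanLin M.transpose⁻¹ (gradient ψ 0))) := by
  have hMT : IsUnit M.transpose.det := by rwa [Matrix.det_transpose]
  have hinv : ∀ x, Matrix.toEuclideanLin M.transpose (Matrix.toEuclideanLin M.transpose⁻¹ x) = x :=
    fun x => by simp [Matrix.toLpLin_apply, Matrix.mulVec_mulVec, Matrix.mul_nonsing_inv _ hMT]
  have hinv' : ∀ x, Matrix.toEuclideanLin M.transpose⁻¹ (Matrix.toEuclideanLin M.transpose x) = x :=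
    fun x => by simp [Matrix.toLpLin_apply, Matrix.mulVec_mulVec, Matrix.nonsing_inv_mul _ hMT]
  have hψ : Differentiable ℝ ψ := hsmooth.differentiable one_ne_zero
  have hgrad : Continuous (gradient ψ) :=
    (InnerProductSpace.toDual ℝ _).symm.continuous.comp (hsmooth.continuous_fderiv one_ne_zero)
  set q₀ := Matrix.toEuclideanLin M.transpose⁻¹ b -
    Matrix.toEuclideanLin M.transpose⁻¹ (gradient ψ 0) with hq₀
  have hq₀' : Matrix.toEuclideanLin M.transpose q₀ = b - gradient ψ 0 := by
    rw [hq₀, map_sub, hinv, hinv]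
  obtain ⟨hp0, hr0⟩ := tendsto_zero_of_oscillatory_system
    (A := (Matrix.toEuclideanLin M).toContinuousLinearMap)
    (B := (Matrix.toEuclideanLin M.transpose).toContinuousLinearMap)
    (g := fun x => gradient ψ x - gradient ψ 0) (r := fun t => q t - q₀) (p := p)
    (fun x y => by
      have h := Matrix.toEuclideanLin_conjTranspose_eq_adjoint M
      rw [Matrix.conjTranspose_eq_transpose_of_trivial] at h
      simp only [LinearMap.coe_toContinuousLinearMap']
      rw [h, LinearMap.adjoint_inner_left])
    (Function.LeftInverse.injective hinv')
    (hgrad.sub continuous_const) (sub_self _)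
    (fun x hx => by simpa using hconv.inner_gradient_sub_pos hψ hx)
    (fun t ht => (hq t ht).sub_const q₀)
    (fun t ht => (hp t ht).congr_deriv (by
      simp only [LinearMap.coe_toContinuousLinearMap', map_sub, hq₀']
      abel))
  exact ⟨hp0, tendsto_sub_nhds_zero_iff.1 hr0⟩
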